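/- Let ℓ ≥ 2 and j,k ∈ {0,…,ℓ−1} (possibly equal). Let U be a complex 4×4 matrix with entries U_{(a,c),(a′,c′)} indexed by pairs in {0,1}×{0,1}. On the complex vector space of functions on {0,…,2^ℓ−1}×{0,…,2^ℓ−1}×{0,1}×{0,1}, with standard basis (e_{x,y,b₁,b₂}), define: Ĉ_j e_{x,y,b₁,b₂} = e_{x′,y,b₁′,b₂} where (x′,b₁′) = T_j^ℓ(x,b₁); Ĉ_k e_{x,y,b₁,b₂} = e_{x,y′,b₁,b₂′} where (y′,b₂′) = T_k^ℓ(y,b₂); and Û e_{x,y,b₁,b₂} = Σ_{a,c∈{0,1}} U_{(a,c),(b₁,b₂)}·e_{x,y,a,c}. Then for all x,y ∈ {0,…,2^ℓ−1}: Ĉ_j^{−1} Ĉ_k^{−1} Û Ĉ_k Ĉ_j e_{x,y,0,0} = Σ_{a,c∈{0,1}} U_{(a,c),(x_j,y_k)}·e_{x−2^j·x_j+2^j·a, y−2^k·y_k+2^k·c, 0,0}; i.e., the two-qubit gate U is realized on the j-th qubit of the first register and the k-th qubit of the second register, with both auxiliary qubits returned to 0. -/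

import Mathlib

/-- The `i`-th binary digit of the natural number `x`. -/
def bitAt (x i : ℕ) : ℕ := x / 2 ^ i % 2

/-- The `i`-th binary digit, as an element of `Fin 2`. -/
def bitF (x i : ℕ) : Fin 2 := ⟨bitAt x i, Nat.mod_lt _ (by norm_num)⟩

/-- The bit-transfer map `T_j^ℓ` on `{0,…,2^ℓ−1} × {0,1}`:
`T_j^ℓ(x,b) = ((x − 2^j·(b ⊕ x_j)) mod 2^ℓ, b ⊕ x_j)`. -/
def bitTransfer (ℓ j : ℕ) (p : Fin (2 ^ ℓ) × Fin 2) : Fin (2 ^ ℓ) × Fin 2 :=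
  (⟨((p.1 : ℕ) + 2 ^ ℓ - 2 ^ j * (((p.2 : ℕ) + bitAt (p.1 : ℕ) j) % 2)) % 2 ^ ℓ,
      Nat.mod_lt _ (pow_pos (by norm_num) ℓ)⟩,
   ⟨((p.2 : ℕ) + bitAt (p.1 : ℕ) j) % 2, Nat.mod_lt _ (by norm_num)⟩)

/-- Index set for the bipartite register `ℂ^{2^ℓ} ⊗ ℂ^{2^ℓ} ⊗ ℂ² ⊗ ℂ²`. -/
abbrev Reg2 (ℓ : ℕ) := Fin (2 ^ ℓ) × Fin (2 ^ ℓ) × Fin 2 × Fin 2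

/-- The complex vector space of functions on `{0,…,2^ℓ−1}²×{0,1}²`. -/
abbrev V2 (ℓ : ℕ) := Reg2 ℓ → ℂ

/-- Standard basis vector `e_{x,y,b₁,b₂}`. -/
noncomputable def eb2 (ℓ : ℕ) (x y : Fin (2 ^ ℓ)) (b₁ b₂ : Fin 2) : V2 ℓ :=
  fun p => if p = (x, y, b₁, b₂) then 1 else 0

/-- Linear extension of a map `g` on basis indices: `e_q ↦ e_{g q}`. -/
noncomputable def permOp {ι : Type*} [Fintype ι] [DecidableEq ι] (g : ι → ι) :
    (ι → ℂ) → (ι → ℂ) :=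
  fun f p => ∑ q, f q * (if p = g q then 1 else 0)

/-- `Ĉ_j`: the bit-transfer `T_j^ℓ` acting on `(x, b₁)` (first register, first qubit). -/
noncomputable def Cop1 (ℓ j : ℕ) : V2 ℓ → V2 ℓ :=
  permOp fun q : Reg2 ℓ =>
    ((bitTransfer ℓ j (q.1, q.2.2.1)).1, q.2.1,
      (bitTransfer ℓ j (q.1, q.2.2.1)).2, q.2.2.2)

/-- `Ĉ_k`: the bit-transfer `T_k^ℓ` acting on `(y, b₂)` (second register, second qubit). -/
noncomputable def Cop2 (ℓ k : ℕ) : V2 ℓ → V2 ℓ :=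
  permOp fun q : Reg2 ℓ =>
    (q.1, (bitTransfer ℓ k (q.2.1, q.2.2.2)).1,
      q.2.2.1, (bitTransfer ℓ k (q.2.1, q.2.2.2)).2)

/-- `Û`: the two-qubit gate `U` acting on the two auxiliary qubits,
`Û e_{x,y,b₁,b₂} = Σ_{a,c} U_{(a,c),(b₁,b₂)} e_{x,y,a,c}`. -/
noncomputable def UopV2 (ℓ : ℕ) (U : Fin 2 × Fin 2 → Fin 2 × Fin 2 → ℂ) : V2 ℓ → V2 ℓ :=
  fun f p => ∑ b₁ : Fin 2, ∑ b₂ : Fin 2,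
    U (p.2.2.1, p.2.2.2) (b₁, b₂) * f (p.1, p.2.1, b₁, b₂)

/-- The number obtained from `x` by replacing its `j`-th binary digit by `a`:
`x − 2^j·x_j + 2^j·a`. -/
def sigma1 (ℓ j : ℕ) (x : Fin (2 ^ ℓ)) (a : Fin 2) : Fin (2 ^ ℓ) :=
  ⟨((x : ℕ) - 2 ^ j * bitAt (x : ℕ) j + 2 ^ j * (a : ℕ)) % 2 ^ ℓ,
    Nat.mod_lt _ (pow_pos (by norm_num) ℓ)⟩

theorem bitAt_eq_of_decomp {j h a r : ℕ} (ha : a < 2) (hr : r < 2 ^ j) :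
    bitAt (2 ^ j * (2 * h + a) + r) j = a := by
  rw [bitAt, Nat.mul_add_div (by positivity), Nat.div_eq_of_lt hr]
  omega

theorem exists_decomp (x j : ℕ) :
    ∃ h r, r < 2 ^ j ∧ x = 2 ^ j * (2 * h + bitAt x j) + r :=
  ⟨x / 2 ^ j / 2, x % 2 ^ j, Nat.mod_lt _ (by positivity), by
    rw [bitAt, Nat.div_add_mod, Nat.div_add_mod]⟩

theorem decomp_lt {ℓ j h a b r : ℕ} (hj : j < ℓ) (ha : a < 2) (hr : r < 2 ^ j)
    (hx : 2 ^ j * (2 * h + b) + r < 2 ^ ℓ) : 2 ^ j * (2 * h + a) + r < 2 ^ ℓ := by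
  obtain ⟨m, rfl⟩ := Nat.exists_eq_add_of_lt hj
  have hpow : 2 ^ (j + m + 1) = 2 ^ j * (2 * 2 ^ m) := by ring
  rw [hpow] at hx ⊢
  have hh : 2 * h + b < 2 * 2 ^ m :=
    lt_of_mul_lt_mul_left (lt_of_le_of_lt (Nat.le_add_right _ _) hx) (Nat.zero_le _)
  have hle : 2 ^ j * (2 * h + a + 1) ≤ 2 ^ j * (2 * 2 ^ m) :=
    Nat.mul_le_mul_left _ (by omega)
  rw [Nat.mul_add _ _ 1] at hle
  omega

theorem sigma1_val {ℓ j h r : ℕ} (hj : j < ℓ) {x : Fin (2 ^ ℓ)} (hr : r < 2 ^ j)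
    (hx : (x : ℕ) = 2 ^ j * (2 * h + bitAt x j) + r) (a : Fin 2) :
    (sigma1 ℓ j x a : ℕ) = 2 ^ j * (2 * h + a) + r := by
  have hsub : (x : ℕ) - 2 ^ j * bitAt x j + 2 ^ j * a = 2 ^ j * (2 * h + a) + r := by
    rw [Nat.mul_add] at hx ⊢
    omega
  have hlt : 2 ^ j * (2 * h + a) + r < 2 ^ ℓ :=
    decomp_lt hj a.isLt hr (hx ▸ x.isLt)
  rw [sigma1, Fin.val_mk, hsub, Nat.mod_eq_of_lt hlt]

theorem sigma1_bitF {ℓ j : ℕ} (hj : j < ℓ) (x : Fin (2 ^ ℓ)) :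
    sigma1 ℓ j x (bitF x j) = x := by
  obtain ⟨h, r, hr, hx⟩ := exists_decomp x j
  exact Fin.ext ((sigma1_val hj hr hx _).trans hx.symm)

theorem bitTransfer_sigma1 {ℓ j : ℕ} (hj : j < ℓ) (x : Fin (2 ^ ℓ)) (a : Fin 2) :
    bitTransfer ℓ j (sigma1 ℓ j x a, 0) = (sigma1 ℓ j x 0, a) := by
  obtain ⟨h, r, hr, hx⟩ := exists_decomp x j
  have hval := sigma1_val hj hr hx
  have hbit : bitAt (sigma1 ℓ j x a) j = a := by
    rw [hval, bitAt_eq_of_decomp a.isLt hr]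
  have hmod : (((0 : Fin 2) : ℕ) + a) % 2 = a := by
    rw [Fin.val_zero, zero_add, Nat.mod_eq_of_lt a.isLt]
  have hclear : (sigma1 ℓ j x a : ℕ) + 2 ^ ℓ - 2 ^ j * a = sigma1 ℓ j x 0 + 2 ^ ℓ := by
    rw [hval a, hval 0, Nat.mul_add, Nat.mul_add, Fin.val_zero, Nat.mul_zero]
    omega
  refine Prod.ext (Fin.ext ?_) (Fin.ext ?_)
  · simp only [bitTransfer, hbit, hmod, hclear]
    rw [Nat.add_mod_right, Nat.mod_eq_of_lt (Fin.isLt _)]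
  · simp only [bitTransfer, hbit, hmod]

theorem permOp_ite_eq {ι : Type*} [Fintype ι] [DecidableEq ι] (g : ι → ι) (i : ι) :
    permOp g (fun p => if p = i then 1 else 0) = fun p => if p = g i then 1 else 0 := by
  ext p
  simp only [permOp, ite_mul, one_mul, zero_mul, Finset.sum_ite_eq', Finset.mem_univ,
    if_true]

theorem permOp_sum_smul {ι κ : Type*} [Fintype ι] [DecidableEq ι] (g : ι → ι)
    (s : Finset κ) (c : κ → ℂ) (f : κ → ι → ℂ) :
    permOp g (∑ t ∈ s, c t • f t) = ∑ t ∈ s, c t • permOp g (f t) := by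
  ext p
  simp only [permOp, Finset.sum_apply, Pi.smul_apply, smul_eq_mul, Finset.sum_mul,
    Finset.mul_sum, mul_assoc]
  exact Finset.sum_comm

theorem Cop1_eb2_sigma1 {ℓ j : ℕ} (hj : j < ℓ) (x y : Fin (2 ^ ℓ)) (a b : Fin 2) :
    Cop1 ℓ j (eb2 ℓ (sigma1 ℓ j x a) y 0 b) = eb2 ℓ (sigma1 ℓ j x 0) y a b := by
  unfold Cop1 eb2
  rw [permOp_ite_eq]
  simp only [bitTransfer_sigma1 hj]

theorem Cop2_eb2_sigma1 {ℓ k : ℕ} (hk : k < ℓ) (x y : Fin (2 ^ ℓ)) (a c : Fin 2) :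
    Cop2 ℓ k (eb2 ℓ x (sigma1 ℓ k y c) a 0) = eb2 ℓ x (sigma1 ℓ k y 0) a c := by
  unfold Cop2 eb2
  rw [permOp_ite_eq]
  simp only [bitTransfer_sigma1 hk]

theorem UopV2_eb2 (ℓ : ℕ) (U : Fin 2 × Fin 2 → Fin 2 × Fin 2 → ℂ) (x y : Fin (2 ^ ℓ))
    (b₁ b₂ : Fin 2) :
    UopV2 ℓ U (eb2 ℓ x y b₁ b₂) =
      ∑ t : Fin 2 × Fin 2, U t (b₁, b₂) • eb2 ℓ x y t.1 t.2 := by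
  ext ⟨x', y', a, c⟩
  simp only [UopV2, eb2, ← Fintype.sum_prod_type', Finset.sum_apply, Pi.smul_apply, smul_eq_mul]
  by_cases hx : x' = x <;> by_cases hy : y' = y <;> simp [hx, hy]

/-- The two-qubit gate `U` is realized on the `j`-th qubit of the first register and the
`k`-th qubit of the second register, with both auxiliary qubits returned to `0`.  Here
`Dj` and `Dk` are the (two-sided) inverses `Ĉ_j^{-1}` and `Ĉ_k^{-1}`. -/
theorem twoQubit_gate_via_bitTransfer_bipartite (ℓ : ℕ) (hℓ : 2 ≤ ℓ) (j k : ℕ)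
    (hj : j < ℓ) (hk : k < ℓ)
    (U : Fin 2 × Fin 2 → Fin 2 × Fin 2 → ℂ)
    (Dj Dk : V2 ℓ → V2 ℓ)
    (hDj₁ : ∀ f, Dj (Cop1 ℓ j f) = f) (hDj₂ : ∀ f, Cop1 ℓ j (Dj f) = f)
    (hDk₁ : ∀ f, Dk (Cop2 ℓ k f) = f) (hDk₂ : ∀ f, Cop2 ℓ k (Dk f) = f)
    (x y : Fin (2 ^ ℓ)) :
    Dj (Dk (UopV2 ℓ U (Cop2 ℓ k (Cop1 ℓ j (eb2 ℓ x y 0 0))))) =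
      ∑ a : Fin 2, ∑ c : Fin 2,
        U (a, c) (bitF (x : ℕ) j, bitF (y : ℕ) k) •
          eb2 ℓ (sigma1 ℓ j x a) (sigma1 ℓ k y c) 0 0 := by
  have hC : Cop2 ℓ k (Cop1 ℓ j (eb2 ℓ x y 0 0)) =
      eb2 ℓ (sigma1 ℓ j x 0) (sigma1 ℓ k y 0) (bitF x j) (bitF y k) := by
    have h := congrArg (Cop2 ℓ k) (Cop1_eb2_sigma1 hj x (sigma1 ℓ k y (bitF y k)) (bitF x j) 0)
    rwa [Cop2_eb2_sigma1 hk, sigma1_bitF hj, sigma1_bitF hk] at h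
  rw [hC, UopV2_eb2, ← Fintype.sum_prod_type']
  have hU : ∑ t : Fin 2 × Fin 2, U t (bitF x j, bitF y k) •
        eb2 ℓ (sigma1 ℓ j x 0) (sigma1 ℓ k y 0) t.1 t.2 =
      Cop2 ℓ k (Cop1 ℓ j (∑ t : Fin 2 × Fin 2, U t (bitF x j, bitF y k) •
        eb2 ℓ (sigma1 ℓ j x t.1) (sigma1 ℓ k y t.2) 0 0)) := by
    rw [Cop1, permOp_sum_smul, ← Cop1, Cop2, permOp_sum_smul, ← Cop2]
    simp only [Cop1_eb2_sigma1 hj, Cop2_eb2_sigma1 hk]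
  rw [hU, hDk₁, hDj₁]
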